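/- arXiv:2102.11575 — 2 statements merged into one kernel-verified Lean document; each statement's English description precedes it below -/
import Mathlib

section
/- The product-form estimator is a minimum variance unbiased estimator: let φ : S → ℝ be measurable and let f be a measurable real-valued function on S^N such that E[f(X^1,…,X^N)] = μ(φ) whenever X^1,…,X^N are i.i.d. with common law μ, for every product-form probability measure μ = μ_1 × ⋯ × μ_K on S with μ(|φ|) < ∞. Then for every such μ, Var(f(X^1,…,X^N)) ≥ Var(μ_×^N(φ)). -/
open MeasureTheory ProbabilityTheory Filter
open scoped ENNReal NNReal BigOperators Topology

/-- The product-form estimator `μ_×^N(φ)`, viewed as a function of the `N` i.i.d.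
samples `x^1, …, x^N ∈ S = S_1 × ⋯ × S_K` (here `x n k` is the `k`-th component of
the `n`-th sample): the average of `φ` over all `N^K` permuted tuples. -/
noncomputable def prodEstFn {K N : ℕ} {S : Fin K → Type*}
    (φ : (∀ k, S k) → ℝ) (x : Fin N → ∀ k, S k) : ℝ :=
  (∑ n : Fin K → Fin N, φ fun k => x (n k) k) / (N : ℝ) ^ K

/-- Signed sum over subsets containing the range of `h` detects surjectivity. -/
lemma signed_sum_surj {N : ℕ} (h : Fin N → Fin N) :
    ∑ B : Finset (Fin N), (-1 : ℝ) ^ B.card * (if ∀ n, h n ∈ B then 1 else 0)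
      = if Function.Surjective h then (-1 : ℝ) ^ N else 0 := by
  classical
  split_ifs with hs
  · rw [Finset.sum_eq_single Finset.univ]
    · simp
    · intro B _ hB
      rw [if_neg, mul_zero]
      intro hh
      apply hB
      ext j
      obtain ⟨i, rfl⟩ := hs j
      simp [hh i]
    · simp
  · unfold Function.Surjective at hs
    push Not at hs
    obtain ⟨j, hj⟩ := hs
    refine Finset.sum_involution (fun B _ => if j ∈ B then B.erase j else insert j B) ?_ ?_ ?_ ?_
    · intro B _
      by_cases hB : j ∈ B
      · have e : (∀ n, h n ∈ B.erase j) ↔ ∀ n, h n ∈ B := by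
          simp [hj]
        have c : B.card = (B.erase j).card + 1 := (Finset.card_erase_add_one hB).symm
        simp only [hB, if_true, e]
        rw [c, pow_succ]; ring
      · have e : (∀ n, h n ∈ insert j B) ↔ ∀ n, h n ∈ B := by
          simp [hj]
        simp only [hB, if_false, e, Finset.card_insert_of_notMem hB]
        rw [pow_succ]; ring
    · intro B _ _ hB
      by_cases hjB : j ∈ B
      · simp only [hjB, if_true] at hB
        rw [← hB] at hjB
        simp at hjB
      · simp only [hjB, if_false] at hB
        rw [← hB] at hjB
        simp at hjB
    · simp
    · intro B _
      by_cases hjB : j ∈ B <;> simp [hjB]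

/-- Inclusion-exclusion: vanishing sums over boxes force the vanishing of the symmetrisation. -/
lemma sum_perm_eq_zero {K N : ℕ} (hK : 0 < K) (hN : 0 < N)
    (g : (Fin N → Fin K → Fin N) → ℝ)
    (H : ∀ A : Fin K → Finset (Fin N), (∀ k, (A k).Nonempty) →
      ∑ m : Fin N → Fin K → Fin N, (if ∀ n k, m n k ∈ A k then g m else 0) = 0) :
    ∑ σ : Fin K → Equiv.Perm (Fin N), g (fun n k => σ k n) = 0 := by
  classical
  have H' : ∀ A : Fin K → Finset (Fin N),
      ∑ m : Fin N → Fin K → Fin N, (if ∀ n k, m n k ∈ A k then g m else 0) = 0 := by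
    intro A
    by_cases hA : ∀ k, (A k).Nonempty
    · exact H A hA
    · push Not at hA
      obtain ⟨k, hk⟩ := hA
      refine Finset.sum_eq_zero fun m _ => ?_
      rw [if_neg]
      intro hm
      have := hm ⟨0, hN⟩ k
      simp [hk] at this
  have key : ∑ m : Fin N → Fin K → Fin N,
      g m * ∏ k, (if Function.Surjective (fun n => m n k) then (-1 : ℝ) ^ N else 0) = 0 := by
    calc _ = ∑ m : Fin N → Fin K → Fin N, g m * ∑ A : Fin K → Finset (Fin N),
            ∏ k, ((-1 : ℝ) ^ (A k).card * (if ∀ n, m n k ∈ A k then 1 else 0)) := by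
          refine Finset.sum_congr rfl fun m _ => ?_
          congr 1
          simp_rw [← signed_sum_surj]
          rw [Finset.prod_univ_sum]
          simp
      _ = ∑ A : Fin K → Finset (Fin N), (∏ k, (-1 : ℝ) ^ (A k).card) *
            ∑ m : Fin N → Fin K → Fin N, (if ∀ n k, m n k ∈ A k then g m else 0) := by
          simp_rw [Finset.mul_sum]
          rw [Finset.sum_comm]
          refine Finset.sum_congr rfl fun A _ => Finset.sum_congr rfl fun m _ => ?_
          rw [Finset.prod_mul_distrib]
          by_cases hm : ∀ n k, m n k ∈ A k
          · rw [if_pos hm, Finset.prod_congr rfl (fun k _ => if_pos (fun n => hm n k))]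
            simp [mul_comm]
          · rw [if_neg hm]
            push Not at hm
            obtain ⟨n, k, hnk⟩ := hm
            have : ∏ k, (if ∀ n, m n k ∈ A k then (1 : ℝ) else 0) = 0 :=
              Finset.prod_eq_zero (Finset.mem_univ k) (if_neg (fun h => hnk (h n)))
            rw [this]; simp
      _ = 0 := by simp [H']
  have inj : Function.Injective
      (fun (σ : Fin K → Equiv.Perm (Fin N)) => (fun n k => σ k n : Fin N → Fin K → Fin N)) := by
    intro σ τ h
    funext k
    ext n
    have := congrFun (congrFun h n) k
    simpa using congrArg Fin.val this
  have key2 := Fintype.sum_of_injective _ inj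
    (fun σ => g (fun n k => σ k n) * ((-1 : ℝ) ^ N) ^ K)
    (fun m => g m * ∏ k, (if Function.Surjective (fun n => m n k) then (-1 : ℝ) ^ N else 0))
    (by
      intro m hm
      by_cases hs : ∀ k, Function.Surjective (fun n => m n k)
      · exfalso
        apply hm
        refine ⟨fun k => Equiv.ofBijective (fun n => m n k)
          (Finite.surjective_iff_bijective.mp (hs k)), ?_⟩
        funext n k
        simp
      · push Not at hs
        obtain ⟨k, hk⟩ := hs
        rw [Finset.prod_eq_zero (Finset.mem_univ k) (if_neg hk), mul_zero])
    (by
      intro σ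
      congr 1
      rw [Finset.prod_congr rfl (fun k _ => if_pos (σ k).surjective)]
      simp)
  rw [key, ← Finset.sum_mul] at key2
  rcases mul_eq_zero.mp key2 with h | h
  · exact h
  · exact absurd h (by positivity)

/-- Picking one component from each sample yields the product law. -/
lemma map_pick {K N : ℕ} {S : Fin K → Type*} [∀ k, MeasurableSpace (S k)]
    (μ : ∀ k, Measure (S k)) [∀ k, IsProbabilityMeasure (μ k)] (n : Fin K → Fin N) :
    MeasurePreserving (fun (x : Fin N → ∀ k, S k) k => x (n k) k)
      (Measure.pi (fun _ : Fin N => Measure.pi μ)) (Measure.pi μ) := by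
  classical
  have hm : Measurable (fun (x : Fin N → ∀ k, S k) k => x (n k) k) := by fun_prop
  refine ⟨hm, ?_⟩
  symm
  refine Measure.pi_eq fun s hs => ?_
  rw [Measure.map_apply hm (.univ_pi hs)]
  have : (fun (x : Fin N → ∀ k, S k) k => x (n k) k) ⁻¹' (Set.univ.pi s)
      = Set.univ.pi (fun i => Set.univ.pi (fun k => if n k = i then s k else Set.univ)) := by
    ext x
    simp only [Set.mem_preimage, Set.mem_pi, Set.mem_univ, true_imp_iff]
    constructor
    · intro h i k
      split_ifs with hi
      · subst hi; exact h k
      · trivial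
    · intro h k
      simpa using h (n k) k
  rw [this, Measure.pi_pi]
  simp_rw [Measure.pi_pi]
  rw [Finset.prod_comm]
  refine Finset.prod_congr rfl fun k _ => ?_
  rw [Finset.prod_eq_single (n k)]
  · simp
  · intro i _ hi
    rw [if_neg (Ne.symm hi)]; simp
  · simp

/-- Permuting the samples component-wise preserves their law. -/
lemma map_perm {K N : ℕ} {S : Fin K → Type*} [∀ k, MeasurableSpace (S k)]
    (μ : ∀ k, Measure (S k)) [∀ k, IsProbabilityMeasure (μ k)]
    (σ : Fin K → Equiv.Perm (Fin N)) :
    MeasurePreserving (fun (x : Fin N → ∀ k, S k) n k => x (σ k n) k)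
      (Measure.pi (fun _ : Fin N => Measure.pi μ))
      (Measure.pi (fun _ : Fin N => Measure.pi μ)) := by
  classical
  have hm : Measurable (fun (x : Fin N → ∀ k, S k) n k => x (σ k n) k) := by fun_prop
  refine ⟨hm, ?_⟩
  symm
  refine Measure.pi_eq_generateFrom
    (C := fun _ => Set.pi Set.univ '' Set.pi Set.univ fun k => {s : Set (S k) | MeasurableSet s})
    (fun _ => generateFrom_pi) (fun _ => isPiSystem_pi)
    (fun _ => ⟨fun _ => Set.univ, fun _ => ⟨fun _ => Set.univ, by simp, by simp⟩,
      fun _ => by simp, by simp [Set.iUnion_const]⟩) ?_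
  intro s hs
  choose t ht hts using hs
  have ht' : ∀ i k, MeasurableSet (t i k) := fun i k => ht i k (Set.mem_univ k)
  obtain rfl : (fun i => Set.univ.pi (t i)) = s := funext hts
  rw [Measure.map_apply hm (.univ_pi fun i => .univ_pi (ht' i))]
  have : (fun (x : Fin N → ∀ k, S k) n k => x (σ k n) k) ⁻¹'
        (Set.univ.pi fun i => Set.univ.pi (t i))
      = Set.univ.pi (fun i => Set.univ.pi (fun k => t ((σ k).symm i) k)) := by
    ext x
    simp only [Set.mem_preimage, Set.mem_pi, Set.mem_univ, true_imp_iff]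
    constructor
    · intro h i k
      simpa using h ((σ k).symm i) k
    · intro h i k
      simpa using h (σ k i) k
  rw [this, Measure.pi_pi]
  simp_rw [Measure.pi_pi]
  rw [Finset.prod_comm, Finset.prod_comm (s := Finset.univ (α := Fin N))]
  refine Finset.prod_congr rfl fun k _ => ?_
  exact Equiv.prod_comp (σ k).symm (fun i => μ k (t i k))

/-- The product-form estimator is unbiased. -/
lemma integral_prodEstFn {K N : ℕ} (hN : 0 < N) {S : Fin K → Type*}
    [∀ k, MeasurableSpace (S k)] (φ : (∀ k, S k) → ℝ)
    (μ : ∀ k, Measure (S k)) [∀ k, IsProbabilityMeasure (μ k)]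
    (hφ : Integrable φ (Measure.pi μ)) :
    Integrable (prodEstFn (N := N) φ) (Measure.pi (fun _ : Fin N => Measure.pi μ)) ∧
    ∫ x, prodEstFn φ x ∂Measure.pi (fun _ : Fin N => Measure.pi μ) = ∫ y, φ y ∂Measure.pi μ := by
  have hi : ∀ n : Fin K → Fin N, Integrable (fun x : Fin N → ∀ k, S k => φ fun k => x (n k) k)
      (Measure.pi (fun _ : Fin N => Measure.pi μ)) :=
    fun n => (map_pick μ n).integrable_comp_of_integrable hφ
  have he : ∀ n : Fin K → Fin N, ∫ x : Fin N → ∀ k, S k, (φ fun k => x (n k) k)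
      ∂(Measure.pi (fun _ : Fin N => Measure.pi μ)) = ∫ y, φ y ∂Measure.pi μ := by
    intro n
    have h := (map_pick (N := N) μ n)
    conv_rhs => rw [← h.map_eq]
    rw [integral_map h.measurable.aemeasurable]
    rw [h.map_eq]
    exact hφ.aestronglyMeasurable
  unfold prodEstFn
  refine ⟨(integrable_finsetSum _ fun n _ => hi n).div_const _, ?_⟩
  rw [integral_div, integral_finsetSum _ fun n _ => hi n]
  simp_rw [he]
  have : (N : ℝ) ≠ 0 := by positivity
  simp
  field_simp

/-- The product-form estimator is invariant under component-wise permutations. -/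
lemma prodEstFn_perm {K N : ℕ} {S : Fin K → Type*} (φ : (∀ k, S k) → ℝ)
    (σ : Fin K → Equiv.Perm (Fin N)) (x : Fin N → ∀ k, S k) :
    prodEstFn φ (fun n k => x (σ k n) k) = prodEstFn φ x := by
  unfold prodEstFn
  congr 1
  exact Equiv.sum_comp (Equiv.piCongrRight σ) (fun n : Fin K → Fin N => φ fun k => x (n k) k)

lemma measurable_prodEstFn {K N : ℕ} {S : Fin K → Type*} [∀ k, MeasurableSpace (S k)]
    (φ : (∀ k, S k) → ℝ) (hφm : Measurable φ) :
    Measurable (prodEstFn (N := N) φ) := by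
  unfold prodEstFn
  refine Measurable.div_const (Finset.measurable_sum _ fun n _ => ?_) _
  exact hφm.comp (by fun_prop)

/-- Symmetrising an unbiased estimator gives the product-form estimator, pointwise. -/
lemma symmetrise_eq {K N : ℕ} (hK : 0 < K) (hN : 0 < N) {S : Fin K → Type*}
    [∀ k, MeasurableSpace (S k)]
    (φ : (∀ k, S k) → ℝ) (hφm : Measurable φ)
    (f : (Fin N → ∀ k, S k) → ℝ) (hfm : Measurable f)
    (hf_unbiased : ∀ μ : ∀ k, Measure (S k), (∀ k, IsProbabilityMeasure (μ k)) →
      Integrable φ (Measure.pi μ) →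
      ∫ x, f x ∂Measure.pi (fun _ : Fin N => Measure.pi μ) = ∫ y, φ y ∂Measure.pi μ)
    (x : Fin N → ∀ k, S k) :
    ∑ σ : Fin K → Equiv.Perm (Fin N), (f (fun n k => x (σ k n) k) - prodEstFn φ x) = 0 := by
  classical
  rw [Finset.sum_congr rfl (fun (σ : Fin K → Equiv.Perm (Fin N)) _ =>
    congrArg (fun r => f (fun n k => x (σ k n) k) - r) (prodEstFn_perm φ σ x).symm)]
  refine sum_perm_eq_zero hK hN (fun m => f (fun n k => x (m n k) k) -
    prodEstFn φ (fun n k => x (m n k) k)) ?_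
  intro A hA
  let ν : Fin K → Measure (Fin N) := fun k => uniformOn (A k : Set (Fin N))
  have hν : ∀ k, IsProbabilityMeasure (ν k) := fun k =>
    isProbabilityMeasure_uniformOn (Finset.finite_toSet _) (by simpa using hA k)
  let μ : ∀ k, Measure (S k) := fun k => (ν k).map (fun j => x j k)
  have hxm : ∀ k, Measurable (fun j => x j k) := fun k => measurable_of_finite _
  have hμ : ∀ k, IsProbabilityMeasure (μ k) := fun k =>
    Measure.isProbabilityMeasure_map (hxm k).aemeasurable
  have hpi : Measure.pi μ = (Measure.pi ν).map (fun m k => x (m k) k) :=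
    (Measure.pi_map_pi (fun k => (hxm k).aemeasurable)).symm
  have hm1 : Measurable (fun (m : Fin K → Fin N) k => x (m k) k) := measurable_of_finite _
  have : IsProbabilityMeasure ((Measure.pi ν).map (fun m k => x (m k) k)) :=
    Measure.isProbabilityMeasure_map hm1.aemeasurable
  have hpi2 : Measure.pi (fun _ : Fin N => Measure.pi μ) =
      (Measure.pi (fun _ : Fin N => Measure.pi ν)).map (fun m n k => x (m n k) k) := by
    rw [hpi]
    exact (Measure.pi_map_pi (fun _ => hm1.aemeasurable)).symm
  have hm2 : Measurable (fun (m : Fin N → Fin K → Fin N) n k => x (m n k) k) :=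
    measurable_of_finite _
  have hφ : Integrable φ (Measure.pi μ) := by
    rw [hpi, integrable_map_measure hφm.aestronglyMeasurable hm1.aemeasurable]
    exact Integrable.of_finite
  have h1 := hf_unbiased μ hμ hφ
  have h2 := (integral_prodEstFn (N := N) hN φ μ hφ).2
  rw [← h2, hpi2, integral_map hm2.aemeasurable hfm.aestronglyMeasurable,
    integral_map hm2.aemeasurable (measurable_prodEstFn φ hφm).aestronglyMeasurable,
    ← sub_eq_zero, ← integral_sub Integrable.of_finite Integrable.of_finite,
    integral_fintype Integrable.of_finite] at h1
  have hw : ∀ m : Fin N → Fin K → Fin N,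
      (Measure.pi (fun _ : Fin N => Measure.pi ν)).real {m}
        = (∏ k, ((A k).card : ℝ)⁻¹) ^ N * (if ∀ n k, m n k ∈ A k then 1 else 0) := by
    intro m
    have hs : ∀ k j, (ν k).real {j} = ((A k).card : ℝ)⁻¹ * (if j ∈ A k then 1 else 0) := by
      intro k j
      simp only [ν, uniformOn, measureReal_def]
      rw [cond_apply (Finset.measurableSet _)]
      by_cases hj : j ∈ A k
      · have : (A k : Set (Fin N)) ∩ {j} = {j} := by ext i; simp; rintro rfl; exact hj
        rw [this]; simp [hj]
      · have : (A k : Set (Fin N)) ∩ {j} = ∅ := by ext i; simp; rintro h rfl; exact hj h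
        rw [this]; simp [hj]
    have : (Measure.pi (fun _ : Fin N => Measure.pi ν)).real {m} = ∏ n, ∏ k, (ν k).real {m n k} := by
      simp only [measureReal_def, Measure.pi_singleton, ENNReal.toReal_prod]
    rw [this]
    simp_rw [hs, Finset.prod_mul_distrib]
    congr 1
    · simp
    · simp [Finset.prod_ite_zero]
  simp_rw [hw, smul_eq_mul, mul_assoc] at h1
  rw [← Finset.mul_sum] at h1
  rcases mul_eq_zero.mp h1 with h | h
  · exfalso
    have h0 := eq_zero_of_pow_eq_zero h
    rw [Finset.prod_eq_zero_iff] at h0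
    obtain ⟨k, _, hk⟩ := h0
    have := (hA k).card_pos
    simp at hk
    simp [hk] at this
  · refine Eq.trans ?_ h
    refine Finset.sum_congr rfl fun m _ => ?_
    split_ifs <;> simp

/-- **The product-form estimator is a minimum variance unbiased estimator.**
If `f : S^N → ℝ` is measurable and `E[f(X^1,…,X^N)] = μ(φ)` whenever `X^1,…,X^N` are
i.i.d. with common law `μ`, for every product-form probability measure
`μ = μ_1 × ⋯ × μ_K` with `μ(|φ|) < ∞`, then for every such `μ`,
`Var(f(X^1,…,X^N)) ≥ Var(μ_×^N(φ))`. -/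
theorem prodEst_minimum_variance_unbiased
    {K N : ℕ} (hK : 1 < K) (hN : 0 < N) {S : Fin K → Type*}
    [∀ k, MeasurableSpace (S k)]
    (φ : (∀ k, S k) → ℝ) (hφm : Measurable φ)
    (f : (Fin N → ∀ k, S k) → ℝ) (hfm : Measurable f)
    (hf_unbiased : ∀ μ : ∀ k, Measure (S k), (∀ k, IsProbabilityMeasure (μ k)) →
      Integrable φ (Measure.pi μ) →
      ∫ x, f x ∂Measure.pi (fun _ : Fin N => Measure.pi μ) = ∫ y, φ y ∂Measure.pi μ)
    (μ : ∀ k, Measure (S k)) (hμ : ∀ k, IsProbabilityMeasure (μ k))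
    (hφ : Integrable φ (Measure.pi μ)) :
    evariance (prodEstFn φ) (Measure.pi (fun _ : Fin N => Measure.pi μ))
      ≤ evariance f (Measure.pi (fun _ : Fin N => Measure.pi μ)) := by
  have hI := integral_prodEstFn (N := N) hN φ μ hφ
  by_cases hL : MemLp f 2 (Measure.pi (fun _ : Fin N => Measure.pi μ))
  swap
  · rw [evariance_eq_top hfm.aestronglyMeasurable hL]; exact le_top
  have hsym := symmetrise_eq (by omega) hN φ hφm f hfm hf_unbiased
  rw [evariance_eq_lintegral_ofReal, evariance_eq_lintegral_ofReal, hI.2, hf_unbiased μ hμ hφ]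
  set c := ∫ y, φ y ∂Measure.pi μ
  set P := Measure.pi (fun _ : Fin N => Measure.pi μ)
  set C := Fintype.card (Fin K → Equiv.Perm (Fin N)) with hC
  have hCpos : 0 < C := Fintype.card_pos
  have hpt : ∀ x : Fin N → ∀ k, S k, (C : ℝ) * (prodEstFn φ x - c) ^ 2 ≤
      ∑ σ : Fin K → Equiv.Perm (Fin N), (f (fun n k => x (σ k n) k) - c) ^ 2 := by
    intro x
    have h := hsym x
    rw [Finset.sum_sub_distrib, Finset.sum_const, nsmul_eq_mul, Finset.card_univ, ← hC] at h
    have h2 : ∑ σ : Fin K → Equiv.Perm (Fin N), (f (fun n k => x (σ k n) k) - c)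
        = C * (prodEstFn φ x - c) := by
      rw [Finset.sum_sub_distrib, Finset.sum_const, nsmul_eq_mul, Finset.card_univ, ← hC]
      linarith
    have h3 := sq_sum_le_card_mul_sum_sq (s := Finset.univ)
      (f := fun σ : Fin K → Equiv.Perm (Fin N) => f (fun n k => x (σ k n) k) - c)
    rw [h2, Finset.card_univ, ← hC] at h3
    have hc : (0 : ℝ) < C := by exact_mod_cast hCpos
    refine le_of_mul_le_mul_left ?_ hc
    calc _ = (C * (prodEstFn φ x - c)) ^ 2 := by ring
      _ ≤ _ := h3
  have hmeas : Measurable (fun x : Fin N → ∀ k, S k => ENNReal.ofReal ((f x - c) ^ 2)) := by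
    fun_prop
  have hmain : (C : ℝ≥0∞) * ∫⁻ x, ENNReal.ofReal ((prodEstFn φ x - c) ^ 2) ∂P ≤
      C * ∫⁻ x, ENNReal.ofReal ((f x - c) ^ 2) ∂P := by
    calc _ = ∫⁻ x, (C : ℝ≥0∞) * ENNReal.ofReal ((prodEstFn φ x - c) ^ 2) ∂P := by
          rw [lintegral_const_mul' _ _ (by simp)]
      _ ≤ ∫⁻ x, ∑ σ : Fin K → Equiv.Perm (Fin N),
            ENNReal.ofReal ((f (fun n k => x (σ k n) k) - c) ^ 2) ∂P := by
          refine lintegral_mono fun x => ?_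
          have := ENNReal.ofReal_le_ofReal (hpt x)
          rwa [ENNReal.ofReal_mul (by positivity), ENNReal.ofReal_natCast,
            ENNReal.ofReal_sum_of_nonneg (fun _ _ => sq_nonneg _)] at this
      _ = ∑ σ : Fin K → Equiv.Perm (Fin N),
            ∫⁻ x, ENNReal.ofReal ((f (fun n k => x (σ k n) k) - c) ^ 2) ∂P :=
          lintegral_finsetSum _ fun σ _ => hmeas.comp (map_perm μ σ).measurable
      _ = ∑ σ : Fin K → Equiv.Perm (Fin N), ∫⁻ x, ENNReal.ofReal ((f x - c) ^ 2) ∂P :=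
          Finset.sum_congr rfl fun σ _ => (map_perm μ σ).lintegral_comp hmeas
      _ = _ := by rw [Finset.sum_const, nsmul_eq_mul, Finset.card_univ]
  exact (ENNReal.mul_le_mul_iff_right (by exact_mod_cast hCpos.ne') (by simp)).mp hmain
end

section
/- Let φ : S → ℝ be measurable and let f be a measurable real-valued function on S^N that is symmetric, meaning f(x_1^{τ_1(1)},…,x_1^{τ_1(N)},…,x_K^{τ_K(1)},…,x_K^{τ_K(N)}) = f(x_1^1,…,x_1^N,…,x_K^1,…,x_K^N) for all arguments and all permutations τ_1,…,τ_K of [N]. If (∏_{n=1}^N μ)(f) = 0 for every product-form probability measure μ on S with μ(|φ|) < ∞, then f is identically zero. -/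
open MeasureTheory ProbabilityTheory Filter
open scoped ENNReal NNReal BigOperators Topology

lemma aux_inclusion {K N : ℕ} (hN : 0 < N) (F : (Fin N → Fin K → Fin N) → ℝ)
    (hg : ∀ A : Fin K → Finset (Fin N), (∀ k, (A k).Nonempty) →
      ∑ σ : Fin N → Fin K → Fin N, (if ∀ n k, σ n k ∈ A k then F σ else 0) = 0)
    (A : Fin K → Finset (Fin N)) :
    ∑ σ : Fin N → Fin K → Fin N,
      (if (fun k => Finset.univ.image (fun n => σ n k)) = A then F σ else 0) = 0 := by
  have hg' : ∀ A : Fin K → Finset (Fin N),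
      ∑ σ : Fin N → Fin K → Fin N, (if ∀ n k, σ n k ∈ A k then F σ else 0) = 0 := by
    intro A
    by_cases h : ∀ k, (A k).Nonempty
    · exact hg A h
    · push Not at h
      obtain ⟨k, hk⟩ := h
      refine Finset.sum_eq_zero fun σ _ => if_neg fun h => ?_
      have := h ⟨0, hN⟩ k
      simp [hk] at this
  induction A using WellFoundedLT.induction with
  | ind A ih =>
  have key : ∑ σ : Fin N → Fin K → Fin N, (if ∀ n k, σ n k ∈ A k then F σ else 0)
      = ∑ B ∈ Finset.univ.filter (fun B => ∀ k, B k ⊆ A k), ∑ σ : Fin N → Fin K → Fin N,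
      (if (fun k => Finset.univ.image (fun n => σ n k)) = B then F σ else 0) := by
    rw [Finset.sum_comm]
    refine Finset.sum_congr rfl fun σ _ => ?_
    rw [Finset.sum_ite_eq]
    congr 1
    simp only [Finset.mem_filter, Finset.mem_univ, true_and,
      Finset.image_subset_iff, forall_true_left, eq_iff_iff]
    exact forall_comm
  rw [hg' A, Finset.sum_eq_single_of_mem A (by simp)] at key
  · exact key.symm
  · intro B hB hne
    exact ih B (lt_of_le_of_ne (fun k => (Finset.mem_filter.1 hB).2 k) hne)

lemma aux_measure {K N : ℕ} {S : Fin K → Type*}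
    [∀ k, MeasurableSpace (S k)]
    (φ : (∀ k, S k) → ℝ) (hφm : Measurable φ)
    (f : (Fin N → ∀ k, S k) → ℝ) (hfm : Measurable f)
    (hzero : ∀ μ : ∀ k, Measure (S k), (∀ k, IsProbabilityMeasure (μ k)) →
      Integrable φ (Measure.pi μ) →
      ∫ x, f x ∂Measure.pi (fun _ : Fin N => Measure.pi μ) = 0)
    (x : Fin N → ∀ k, S k) (A : Fin K → Finset (Fin N)) (hA : ∀ k, (A k).Nonempty) :
    ∑ σ : Fin N → Fin K → Fin N,
      (if ∀ n k, σ n k ∈ A k then f (fun n k => x (σ n k) k) else 0) = 0 := by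
  let ν : Fin K → Measure (Fin N) := fun k => uniformOn (A k : Set (Fin N))
  have hν : ∀ k, IsProbabilityMeasure (ν k) := fun k =>
    isProbabilityMeasure_uniformOn (A k).finite_toSet (by simpa using hA k)
  have hm : ∀ k, Measurable (fun n => x n k) := fun k => measurable_of_finite _
  let μ : ∀ k, Measure (S k) := fun k => (ν k).map (fun n => x n k)
  have hμ : ∀ k, IsProbabilityMeasure (μ k) := fun k =>
    Measure.isProbabilityMeasure_map (hm k).aemeasurable
  have hpi : Measure.pi μ = (Measure.pi ν).map (fun s k => x (s k) k) :=
    (Measure.pi_map_pi (fun k => (hm k).aemeasurable)).symm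
  have hmm : Measurable (fun (s : Fin K → Fin N) k => x (s k) k) := measurable_of_finite _
  have hpp : Measure.pi (fun _ : Fin N => Measure.pi μ) =
      (Measure.pi (fun _ : Fin N => Measure.pi ν)).map (fun σ n k => x (σ n k) k) := by
    rw [hpi]
    haveI : IsProbabilityMeasure ((Measure.pi ν).map (fun s k => x (s k) k)) :=
      Measure.isProbabilityMeasure_map hmm.aemeasurable
    exact (Measure.pi_map_pi (fun _ => hmm.aemeasurable)).symm
  have h0 := hzero μ hμ (by
    rw [hpi, integrable_map_measure hφm.aestronglyMeasurable hmm.aemeasurable]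
    exact Integrable.of_finite)
  rw [hpp, integral_map (measurable_of_finite _).aemeasurable hfm.aestronglyMeasurable,
    integral_fintype Integrable.of_finite] at h0
  have hs : ∀ k i, (ν k).real {i} = if i ∈ A k then ((A k).card : ℝ)⁻¹ else 0 := by
    intro k i
    simp only [ν, Measure.real, uniformOn, cond_apply (A k).measurableSet]
    split_ifs with h
    · rw [Set.inter_eq_self_of_subset_right (by simpa using h)]
      simp
    · rw [Set.inter_singleton_eq_empty.2 (by simpa using h)]
      simp
  have hc : ∀ σ : Fin N → Fin K → Fin N,
      (Measure.pi (fun _ : Fin N => Measure.pi ν)).real {σ} =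
      (if ∀ n k, σ n k ∈ A k then 1 else 0) * ∏ n : Fin N, ∏ k, ((A k).card : ℝ)⁻¹ := by
    intro σ
    have : (Measure.pi (fun _ : Fin N => Measure.pi ν)).real {σ} =
        ∏ n, ∏ k, (ν k).real {σ n k} := by
      simp [Measure.real, Measure.pi_singleton, ENNReal.toReal_prod]
    rw [this]
    simp only [hs]
    split_ifs with h
    · simp [h]
    · push Not at h
      obtain ⟨n, k, h⟩ := h
      rw [zero_mul]
      exact Finset.prod_eq_zero (Finset.mem_univ n)
        (Finset.prod_eq_zero (Finset.mem_univ k) (if_neg h))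
  have hne : ∏ n : Fin N, ∏ k, ((A k).card : ℝ)⁻¹ ≠ 0 := by
    refine Finset.prod_ne_zero_iff.2 fun _ _ => Finset.prod_ne_zero_iff.2 fun k _ => ?_
    have := (hA k).card_pos
    positivity
  refine (mul_eq_zero.1 ?_).resolve_left hne
  rw [Finset.mul_sum]
  refine Eq.trans ?_ h0
  refine Finset.sum_congr rfl fun σ _ => ?_
  rw [hc]
  split_ifs <;> simp

/-- **Symmetric unbiased estimators of zero vanish identically.**
Let `f : S^N → ℝ` be measurable and symmetric, i.e. invariant under component-wise
permutations of its `N` arguments: for all permutations `τ_1, …, τ_K` of `[N]`,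
`f(x_1^{τ_1(1)},…,x_1^{τ_1(N)},…,x_K^{τ_K(1)},…,x_K^{τ_K(N)}) = f(x_1^1,…,x_K^N)`.
If `(∏_{n=1}^N μ)(f) = 0` for every product-form probability measure
`μ = μ_1 × ⋯ × μ_K` on `S` with `μ(|φ|) < ∞`, then `f` is zero everywhere.
(Here `x : Fin N → ∀ k, S k`, with `x n k` the `k`-th component of the `n`-th sample.) -/
theorem symmetric_zero_estimator_eq_zero
    {K N : ℕ} (hK : 1 < K) (hN : 0 < N) {S : Fin K → Type*}
    [∀ k, MeasurableSpace (S k)]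
    (φ : (∀ k, S k) → ℝ) (hφm : Measurable φ)
    (f : (Fin N → ∀ k, S k) → ℝ) (hfm : Measurable f)
    (hsym : ∀ (x : Fin N → ∀ k, S k) (τ : Fin K → Equiv.Perm (Fin N)),
      f (fun n k => x (τ k n) k) = f x)
    (hzero : ∀ μ : ∀ k, Measure (S k), (∀ k, IsProbabilityMeasure (μ k)) →
      Integrable φ (Measure.pi μ) →
      ∫ x, f x ∂Measure.pi (fun _ : Fin N => Measure.pi μ) = 0) :
    ∀ x : Fin N → ∀ k, S k, f x = 0 := by
  intro x
  have h := aux_inclusion hN (fun σ => f (fun n k => x (σ n k) k))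
    (aux_measure φ hφm f hfm hzero x) (fun _ => Finset.univ)
  have h2 : ∀ σ : Fin N → Fin K → Fin N,
      (if (fun k => Finset.univ.image (fun n => σ n k)) = (fun _ => Finset.univ)
        then f (fun n k => x (σ n k) k) else 0) =
      (if (fun k => Finset.univ.image (fun n => σ n k)) = (fun _ => Finset.univ)
        then 1 else 0) * f x := by
    intro σ
    split_ifs with hσ
    · have hb : ∀ k, Function.Bijective (fun n => σ n k) := fun k =>
        Finite.surjective_iff_bijective.1
          (fun i => by
            have := (Finset.ext_iff.1 (congrFun hσ k) i).2 (Finset.mem_univ i)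
            simpa using this)
      rw [one_mul, ← hsym x (fun k => Equiv.ofBijective _ (hb k))]
      rfl
    · simp
  simp only [h2] at h
  rw [← Finset.sum_mul] at h
  refine (mul_eq_zero.1 h).resolve_left (ne_of_gt ?_)
  refine Finset.sum_pos' (fun σ _ => by split_ifs <;> simp)
    ⟨fun n _ => n, Finset.mem_univ _, ?_⟩
  rw [if_pos (by funext k; simp)]
  exact one_pos
end
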